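/- arXiv:1610.09780 — 2 statements merged into one kernel-verified Lean document; each statement's English description precedes it below -/
import Mathlib

section
/- Fix a, r > 0 and q, p ∈ (0,1). Let K ~ NegBin(a,q) and, given K = k, let N ~ NegBin(kr, p). Then for every fixed k ≥ 1, the conditional probability P(K = k | N = n) → 0 as n → ∞. -/
open Real Filter

/-- pmf of the (untruncated) negative binomial distribution NegBin(r,p). -/
noncomputable def negBinPmf (r p : ℝ) (y : ℕ) : ℝ :=
  Real.Gamma (y + r) / (Nat.factorial y * Real.Gamma r) * (1 - p) ^ r * p ^ y

lemma gamma_ratio_le (x r : ℝ) (hx : 1 < x) (hr : 0 < r) :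
    Real.Gamma x / Real.Gamma (x + r) ≤ (x - 1) ^ (-r) := by
  have h := Real.convexOn_log_Gamma.slope_mono_adjacent (x := x - 1) (y := x) (z := x + r)
    (by simp; linarith) (by simp; linarith) (by linarith) (by linarith)
  have h0 : 0 < Real.Gamma (x - 1) := Real.Gamma_pos_of_pos (by linarith)
  have h1 : 0 < Real.Gamma x := Real.Gamma_pos_of_pos (by linarith)
  have h2 : 0 < Real.Gamma (x + r) := Real.Gamma_pos_of_pos (by linarith)
  have hg : Real.Gamma x = (x - 1) * Real.Gamma (x - 1) := by
    have := Real.Gamma_add_one (s := x - 1) (by linarith)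
    simpa using this
  have hl : Real.log (Real.Gamma x) = Real.log (x - 1) + Real.log (Real.Gamma (x - 1)) := by
    rw [hg, Real.log_mul (by linarith) h0.ne']
  simp only [Function.comp, sub_sub_cancel, div_one, add_sub_cancel_left] at h
  rw [le_div_iff₀ hr] at h
  rw [← Real.log_le_log_iff (by positivity) (Real.rpow_pos_of_pos (by linarith) _),
    Real.log_rpow (by linarith), Real.log_div h1.ne' h2.ne']
  have : Real.log (x - 1) = Real.log (Real.Gamma x) - Real.log (Real.Gamma (x - 1)) := by linarith
  rw [this]
  linarith

lemma negBinPmf_pos (r p : ℝ) (hr : 0 < r) (hp0 : 0 < p) (hp1 : p < 1) (y : ℕ) :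
    0 < negBinPmf r p y := by
  unfold negBinPmf
  have h1 : 0 < Real.Gamma r := Real.Gamma_pos_of_pos hr
  have h2 : 0 < Real.Gamma (y + r) := Real.Gamma_pos_of_pos (by positivity)
  have h3 : 0 < (1 - p) ^ r := Real.rpow_pos_of_pos (by linarith) _
  positivity

lemma negBinPmf_nonneg (r p : ℝ) (hr : 0 ≤ r) (hp0 : 0 < p) (hp1 : p < 1) (y : ℕ) :
    0 ≤ negBinPmf r p y := by
  rcases hr.eq_or_lt with h | h
  · subst h; simp [negBinPmf]
  · exact (negBinPmf_pos r p h hp0 hp1 y).le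

/-- Fix `a, r > 0` and `q, p ∈ (0,1)`.  Let `K ~ NegBin(a,q)` and, given `K = k`,
let `N ~ NegBin(kr, p)`.  Then for every fixed `k ≥ 1`, the conditional
probability `P(K = k | N = n) → 0` as `n → ∞`. -/
theorem negbin_numclusters_cond_tendsto_zero (a q r p : ℝ)
    (ha : 0 < a) (hq0 : 0 < q) (hq1 : q < 1) (hr : 0 < r) (hp0 : 0 < p) (hp1 : p < 1)
    (k : ℕ) (hk : 1 ≤ k) :
    Tendsto (fun n : ℕ =>
        negBinPmf a q k * negBinPmf (k * r) p n /
          ∑' k' : ℕ, negBinPmf a q k' * negBinPmf (k' * r) p n)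
      atTop (nhds 0) := by
  have hk0 : (0 : ℝ) < k := by exact_mod_cast hk
  have hs : 0 < (k : ℝ) * r := by positivity
  have hs' : 0 < ((k + 1 : ℕ) : ℝ) * r := by positivity
  have hnn : ∀ k' n : ℕ, 0 ≤ negBinPmf a q k' * negBinPmf (k' * r) p n := fun k' n =>
    mul_nonneg (negBinPmf_nonneg a q ha.le hq0 hq1 k')
      (negBinPmf_nonneg _ p (by positivity) hp0 hp1 n)
  set C : ℝ := negBinPmf a q k / negBinPmf a q (k + 1) *
    (Real.Gamma (k * r + r) / Real.Gamma (k * r)) * ((1 - p) ^ (k * r) / (1 - p) ^ (k * r + r))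
    with hC
  have hA := negBinPmf_pos a q ha hq0 hq1 k
  have hB := negBinPmf_pos a q ha hq0 hq1 (k + 1)
  have hG1 : 0 < Real.Gamma (k * r) := Real.Gamma_pos_of_pos hs
  have hG2 : 0 < Real.Gamma (k * r + r) := Real.Gamma_pos_of_pos (by positivity)
  have hP1 : 0 < (1 - p) ^ (k * r) := Real.rpow_pos_of_pos (by linarith) _
  have hP2 : 0 < (1 - p) ^ (k * r + r) := Real.rpow_pos_of_pos (by linarith) _
  have hC0 : 0 < C := by positivity
  have hlim : Tendsto (fun n : ℕ => C * ((n : ℝ) + (k * r - 1)) ^ (-r)) atTop (nhds 0) := by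
    have h1 : Tendsto (fun n : ℕ => (n : ℝ) + (k * r - 1)) atTop atTop :=
      tendsto_atTop_add_const_right _ _ tendsto_natCast_atTop_atTop
    simpa using ((tendsto_rpow_neg_atTop hr).comp h1).const_mul C
  refine squeeze_zero' (Eventually.of_forall fun n => div_nonneg (hnn k n)
    (tsum_nonneg fun k' => hnn k' n)) ?_ hlim
  filter_upwards [eventually_ge_atTop 1] with n hn
  have hn1 : (1 : ℝ) ≤ n := by exact_mod_cast hn
  have hx : 1 < (n : ℝ) + k * r := by linarith
  by_cases hsum : Summable fun k' : ℕ => negBinPmf a q k' * negBinPmf (k' * r) p n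
  · have hle := hsum.le_tsum (k + 1) (fun j _ => hnn j n)
    have hpos : 0 < negBinPmf a q (k + 1) * negBinPmf ((k + 1 : ℕ) * r) p n :=
      mul_pos hB (negBinPmf_pos _ p hs' hp0 hp1 n)
    refine (div_le_div_of_nonneg_left (hnn k n) hpos hle).trans ?_
    have heq : negBinPmf a q k * negBinPmf (k * r) p n /
        (negBinPmf a q (k + 1) * negBinPmf ((k + 1 : ℕ) * r) p n) =
        C * (Real.Gamma (n + k * r) / Real.Gamma (n + k * r + r)) := by
      have e : ((k + 1 : ℕ) : ℝ) * r = k * r + r := by push_cast; ring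
      have hG3 : 0 < Real.Gamma (n + k * r + r) := Real.Gamma_pos_of_pos (by linarith)
      rw [e, hC, negBinPmf.eq_1 (k * r), negBinPmf.eq_1 (k * r + r), ← add_assoc]
      have hf : (0 : ℝ) < Nat.factorial n := by positivity
      field_simp
    rw [heq]
    have := gamma_ratio_le _ r hx hr
    rw [add_sub_assoc] at this
    gcongr
  · rw [tsum_eq_zero_of_not_summable hsum, div_zero]
    have : 0 ≤ ((n : ℝ) + (k * r - 1)) ^ (-r) := Real.rpow_nonneg (by linarith) _
    positivity
end

section
/- Let C_N be drawn from a Kolchin partition model with κ = NegBin(a, q) and μ = NegBin(r, p) (untruncated), for fixed a, r > 0 and q, p ∈ (0,1). Let M_N denote the size of the largest cluster in C_N. Then for all ε > 0, P(M_N / N ≥ ε | N = n) → 0 as n → ∞; i.e., the model exhibits the microclustering property. -/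
open Real Filter Finset
open scoped Classical

/-- In a Kolchin partition model with `K ~ κ` and cluster sizes `N₁,…,N_K` i.i.d. `~ μ`,
the conditional probability (given `N = Σ N_k = n`) of the event `E` on the size vector:
`P(E | N = n) = (Σ_k κ_k Σ_{v : Fin k → ℕ, Σv = n, E v} Π μ_{v i}) / (Σ_k κ_k Σ_{Σv = n} Π μ_{v i})`.
Note that the largest cluster size `M_N` depends only on the size vector `v`. -/
noncomputable def kpCondProb (κ μ : ℕ → ℝ) (n : ℕ) (E : ∀ k : ℕ, (Fin k → ℕ) → Prop) : ℝ :=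
  (∑' k : ℕ, κ k * ∑' v : Fin k → ℕ,
      if (∑ i, v i) = n ∧ E k v then ∏ i, μ (v i) else 0) /
  (∑' k : ℕ, κ k * ∑' v : Fin k → ℕ,
      if (∑ i, v i) = n then ∏ i, μ (v i) else 0)

/-- convolution power -/
noncomputable def cpow (ν : ℕ → ℝ) (k n : ℕ) : ℝ := PowerSeries.coeff n ((PowerSeries.mk ν) ^ k)

lemma piAntidiag_coeff (k n : ℕ) (f : Fin k → ℕ → ℝ) :
    ∑ v ∈ Finset.piAntidiag (Finset.univ : Finset (Fin k)) n, ∏ i, f i (v i)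
      = PowerSeries.coeff n (∏ i, PowerSeries.mk (f i)) := by
  rw [PowerSeries.coeff_prod]
  refine Finset.sum_bij' (fun v _ => Finsupp.equivFunOnFinite.symm v) (fun l _ => (l : Fin k → ℕ)) ?_ ?_ ?_ ?_ ?_
  · intro v hv
    simpa using hv
  · intro l hl
    simpa using hl
  · intro v hv
    rfl
  · intro l hl
    ext; rfl
  · intro v hv
    simp [PowerSeries.coeff_mk]

lemma inner_tsum (k n : ℕ) (E : (Fin k → ℕ) → Prop) (ν : ℕ → ℝ) :
    (∑' v : Fin k → ℕ, if (∑ i, v i) = n ∧ E v then ∏ i, ν (v i) else 0)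
      = ∑ v ∈ Finset.piAntidiag (Finset.univ : Finset (Fin k)) n,
          if E v then ∏ i, ν (v i) else 0 := by
  rw [tsum_eq_sum (s := Finset.piAntidiag (Finset.univ : Finset (Fin k)) n)]
  · apply Finset.sum_congr rfl
    intro v hv
    have : ∑ i, v i = n := by simpa using hv
    simp [this]
  · intro v hv
    have : ¬ ∑ i, v i = n := by simpa using hv
    simp [this]

lemma inner_tsum' (k n : ℕ) (ν : ℕ → ℝ) :
    (∑' v : Fin k → ℕ, if (∑ i, v i) = n then ∏ i, ν (v i) else 0) = cpow ν k n := by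
  have := inner_tsum k n (fun _ => True) ν
  simp only [and_true, if_true] at this
  rw [this, piAntidiag_coeff k n (fun _ => ν)]
  simp [cpow]

lemma marked (k n : ℕ) (φ ν : ℕ → ℝ) (i : Fin (k+1)) :
    ∑ v ∈ Finset.piAntidiag (Finset.univ : Finset (Fin (k+1))) n, φ (v i) * ∏ l, ν (v l)
      = ∑ x ∈ Finset.HasAntidiagonal.antidiagonal n, φ x.1 * ν x.1 * cpow ν k x.2 := by
  have h := piAntidiag_coeff (k+1) n (fun l m => if l = i then φ m * ν m else ν m)
  have h2 : ∀ v : Fin (k+1) → ℕ, φ (v i) * ∏ l, ν (v l)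
      = ∏ l, (if l = i then φ (v l) * ν (v l) else ν (v l)) := by
    intro v
    rw [Fin.prod_univ_succAbove _ i, Fin.prod_univ_succAbove _ i]
    simp [Fin.succAbove_ne, mul_assoc]
  simp_rw [h2]
  rw [h, Fin.prod_univ_succAbove _ i]
  simp only [if_true, Fin.succAbove_ne, if_false, Finset.prod_const, Finset.card_univ, Fintype.card_fin]
  rw [PowerSeries.coeff_mul]
  simp [cpow]

lemma cpow_nonneg {ν : ℕ → ℝ} (hν : ∀ i, 0 ≤ ν i) (k n : ℕ) : 0 ≤ cpow ν k n := by
  have := piAntidiag_coeff k n (fun _ => ν)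
  simp only [Finset.prod_const, Finset.card_univ, Fintype.card_fin] at this
  rw [cpow, ← this]
  exact Finset.sum_nonneg fun v _ => Finset.prod_nonneg fun i _ => hν _

lemma cpow_mul_le {ν : ℕ → ℝ} (hν : ∀ i, 0 ≤ ν i) (k d j m : ℕ) :
    cpow ν k j * cpow ν d m ≤ cpow ν (k+d) (j+m) := by
  conv_rhs => rw [cpow, pow_add, PowerSeries.coeff_mul]
  exact Finset.single_le_sum (f := fun x : ℕ × ℕ => cpow ν k x.1 * cpow ν d x.2)
    (fun x _ => mul_nonneg (cpow_nonneg hν _ _) (cpow_nonneg hν _ _))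
    (show (j,m) ∈ Finset.HasAntidiagonal.antidiagonal (j+m) by simp)

lemma cpow_one (ν : ℕ → ℝ) (m : ℕ) : cpow ν 1 m = ν m := by simp [cpow]

lemma cpow_eq (ν : ℕ → ℝ) (k n : ℕ) : cpow ν k n =
    ∑ v ∈ Finset.piAntidiag (Finset.univ : Finset (Fin k)) n, ∏ i, ν (v i) := by
  rw [piAntidiag_coeff k n (fun _ => ν)]; simp [cpow]

lemma cpow_bound {ν : ℕ → ℝ} (hν : ∀ i, 0 ≤ ν i) (k n : ℕ) (x : ℝ) (hx : 0 < x) :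
    cpow ν k n * x ^ n ≤ (∑ i ∈ Finset.range (n+1), ν i * x ^ i) ^ k := by
  have h1 : (∑ i ∈ Finset.range (n+1), ν i * x ^ i) ^ k
      = ∑ v ∈ Fintype.piFinset (fun _ : Fin k => Finset.range (n+1)), ∏ i, (ν (v i) * x ^ (v i)) := by
    rw [← Finset.prod_univ_sum (fun _ : Fin k => Finset.range (n+1)) (fun _ i => ν i * x ^ i)]; simp
  rw [h1, cpow_eq, Finset.sum_mul]
  have h2 : ∀ v ∈ Finset.piAntidiag (Finset.univ : Finset (Fin k)) n,
      (∏ i, ν (v i)) * x ^ n = ∏ i, (ν (v i) * x ^ (v i)) := by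
    intro v hv
    have : ∑ i, v i = n := by simpa using hv
    rw [Finset.prod_mul_distrib, Finset.prod_pow_eq_pow_sum, this]
  rw [Finset.sum_congr rfl h2]
  apply Finset.sum_le_sum_of_subset_of_nonneg
  · intro v hv
    have : ∑ i, v i = n := by simpa using hv
    simp only [Fintype.mem_piFinset, Finset.mem_range]
    intro i
    have := Finset.single_le_sum (f := v) (fun _ _ => Nat.zero_le _) (Finset.mem_univ i)
    omega
  · intro v _ _
    exact Finset.prod_nonneg fun i _ => mul_nonneg (hν _) (by positivity)

/-- sum over small sizes -/
lemma pow_sum_le {ν : ℕ → ℝ} (hν : ∀ i, 0 ≤ ν i) (k L : ℕ) :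
    (∑ i ∈ Finset.range (L+1), ν i) ^ k ≤ ∑ m ∈ Finset.range (L*k+1), cpow ν k m := by
  have h1 : (∑ i ∈ Finset.range (L+1), ν i) ^ k
      = ∑ v ∈ Fintype.piFinset (fun _ : Fin k => Finset.range (L+1)), ∏ i, ν (v i) := by
    rw [← Finset.prod_univ_sum]; simp
  rw [h1, ← Finset.sum_fiberwise_of_maps_to (t := Finset.range (L*k+1)) (g := fun v => ∑ i, v i)]
  · apply Finset.sum_le_sum
    intro m _
    rw [cpow_eq]
    apply Finset.sum_le_sum_of_subset_of_nonneg
    · intro v hv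
      simpa using (Finset.mem_filter.1 hv).2
    · intro v _ _
      exact Finset.prod_nonneg fun i _ => hν _
  · intro v hv
    simp only [Fintype.mem_piFinset, Finset.mem_range] at hv ⊢
    have := Finset.sum_le_card_nsmul Finset.univ v L (fun i _ => by have := hv i; omega)
    simp at this
    nlinarith

lemma exists_small_x (ν : ℕ → ℝ) (h0 : ν 0 < 1) (n : ℕ) :
    ∃ x : ℝ, 0 < x ∧ ∑ i ∈ Finset.range (n+1), ν i * x ^ i < 1 := by
  have hc : Continuous (fun x : ℝ => ∑ i ∈ Finset.range (n+1), ν i * x ^ i) := by fun_prop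
  have h : ∀ᶠ x in nhds (0:ℝ), ∑ i ∈ Finset.range (n+1), ν i * x ^ i < 1 := by
    apply hc.continuousAt.eventually_lt continuousAt_const
    simpa [Finset.sum_range_succ'] using h0
  have h' : ∀ᶠ x in nhdsWithin (0:ℝ) (Set.Ioi 0), 0 < x ∧ ∑ i ∈ Finset.range (n+1), ν i * x ^ i < 1 :=
    (eventually_mem_nhdsWithin).and (h.filter_mono nhdsWithin_le_nhds)
  exact h'.exists

lemma cpow_bdd {ν : ℕ → ℝ} (hν : ∀ i, 0 ≤ ν i) (h0 : ν 0 < 1) (n : ℕ) :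
    ∃ C : ℝ, ∀ k, cpow ν k n ≤ C := by
  obtain ⟨x, hx, hs⟩ := exists_small_x ν h0 n
  refine ⟨1 / x ^ n, fun k => ?_⟩
  rw [le_div_iff₀ (by positivity)]
  refine (cpow_bound hν k n x hx).trans (pow_le_one₀ ?_ hs.le)
  exact Finset.sum_nonneg fun i _ => mul_nonneg (hν _) (by positivity)

lemma exists_big {ν : ℕ → ℝ} (hν : ∀ i, 0 < ν i) (h0 : ν 0 < 1) {r : ℝ} (hr : 0 < r)
    (hrec : ∀ k : ℕ, ((k:ℝ)+1) * ν (k+1) = (r + k) * ν k) {q : ℝ} (hq0 : 0 < q) (hq1 : q < 1) :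
    ∃ d m : ℕ, 0 < m ∧ 1 < q ^ d * cpow ν d m := by
  have hlow : ∀ k : ℕ, ν 1 / ((k:ℝ)+1) ≤ ν (k+1) := by
    intro k
    rw [div_le_iff₀ (by positivity)]
    induction k with
    | zero => simp
    | succ k ih =>
      have := hrec (k+1)
      push_cast at this ⊢
      nlinarith [hν (k+1)]
  have hns : ¬ Summable ν := by
    intro hs
    have h1 : Summable (fun k => ν (k+1)) := (summable_nat_add_iff 1).2 hs
    have h2 : Summable (fun k : ℕ => ν 1 / ((k:ℝ)+1)) :=
      Summable.of_nonneg_of_le (fun k => by have := hν 1; positivity) hlow h1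
    have h3 : Summable (fun k : ℕ => 1 / ((k:ℝ)+1)) := by
      have := h2.mul_left (1 / ν 1)
      refine this.congr fun k => ?_
      have := (hν 1).ne'
      field_simp
    exact Real.not_summable_one_div_natCast ((summable_nat_add_iff 1).1 (by simpa using h3))
  have ht := (not_summable_iff_tendsto_nat_atTop_of_nonneg (fun i => (hν i).le)).1 hns
  obtain ⟨L, hL⟩ := ((Filter.tendsto_add_atTop_iff_nat 1).2 ht |>.eventually_ge_atTop (2/q)).exists
  have hT : 2 ≤ q * ∑ i ∈ Finset.range (L+1), ν i := by
    rw [div_le_iff₀ hq0] at hL; linarith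
  by_contra! hcon
  have hall : ∀ d m : ℕ, q ^ d * cpow ν d m ≤ 1 := by
    intro d m
    rcases Nat.eq_zero_or_pos m with rfl | hm
    · have : cpow ν d 0 = ν 0 ^ d := by simp [cpow]
      rw [this, ← mul_pow]
      exact pow_le_one₀ (mul_nonneg hq0.le (hν 0).le) (by nlinarith [hν 0])
    · exact hcon d m hm
  have hb : ∀ d : ℕ, (2:ℝ)^d ≤ L*d+1 := by
    intro d
    calc (2:ℝ)^d ≤ (q * ∑ i ∈ Finset.range (L+1), ν i)^d := pow_le_pow_left₀ (by norm_num) hT d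
      _ = q^d * (∑ i ∈ Finset.range (L+1), ν i)^d := mul_pow _ _ _
      _ ≤ q^d * ∑ m ∈ Finset.range (L*d+1), cpow ν d m := by
        gcongr; exact pow_sum_le (fun i => (hν i).le) d L
      _ = ∑ m ∈ Finset.range (L*d+1), q^d * cpow ν d m := Finset.mul_sum _ _ _
      _ ≤ ∑ m ∈ Finset.range (L*d+1), 1 := Finset.sum_le_sum fun m _ => hall d m
      _ = L*d+1 := by simp
  have h2 := tendsto_pow_const_div_const_pow_of_one_lt 1 (show (1:ℝ) < 2 by norm_num)
  have hl : (0:ℝ) < 1 / (L+1) := by positivity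
  obtain ⟨d, hd, hd1⟩ := ((h2.eventually_lt_const hl).and (eventually_ge_atTop 1)).exists
  have := hb d
  rw [div_lt_div_iff₀ (by positivity) (by positivity)] at hd
  have hd1' : (1:ℝ) ≤ d := by exact_mod_cast hd1
  simp at hd
  nlinarith

lemma growth (H : ℕ → ℝ) (hH : ∀ j, 0 ≤ H j) (c R : ℝ) (hc : 0 < c) (hR : 1 < R) (m0 : ℕ)
    (hm0 : 0 < m0) (h1 : ∀ j, c * H j ≤ H (j+1)) (h2 : ∀ j, R * H j ≤ H (j+m0)) :
    ∃ θ C : ℝ, 0 < θ ∧ θ < 1 ∧ 0 < C ∧ ∀ j m, H j ≤ C * θ ^ m * H (j+m) := by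
  obtain ⟨θ, hθ0, hθ1, hθ⟩ : ∃ θ : ℝ, 0 < θ ∧ θ < 1 ∧ 1 ≤ θ ^ m0 * R := by
    have hr : 0 < R⁻¹ := by positivity
    refine ⟨R⁻¹ ^ ((m0:ℝ)⁻¹), by positivity, Real.rpow_lt_one hr.le (inv_lt_one_of_one_lt₀ hR) (by positivity), ?_⟩
    rw [Real.rpow_inv_natCast_pow hr.le hm0.ne']
    rw [inv_mul_cancel₀ (by positivity)]
  set e := min c 1 with he
  have he0 : 0 < e := lt_min hc one_pos
  have he1 : e ≤ 1 := min_le_right _ _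
  have hs : ∀ m j, e ^ m * H j ≤ H (j+m) := by
    intro m
    induction m with
    | zero => intro j; simp
    | succ m ih =>
      intro j
      have a1 := ih j
      have a2 := h1 (j+m)
      have a3 : e * H (j+m) ≤ c * H (j+m) := mul_le_mul_of_nonneg_right (min_le_left _ _) (hH _)
      have a4 := mul_le_mul_of_nonneg_left a1 he0.le
      rw [← add_assoc, pow_succ]
      nlinarith
  refine ⟨θ, 1/((e*θ)^m0), hθ0, hθ1, by positivity, ?_⟩
  intro j m
  induction m using Nat.strong_induction_on generalizing j with
  | _ m ih =>
    rcases lt_or_ge m m0 with hm | hm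
    · rw [div_mul_eq_mul_div, div_mul_eq_mul_div, le_div_iff₀ (by positivity), one_mul, mul_pow]
      have a1 : e^m0 ≤ e^m := pow_le_pow_of_le_one he0.le he1 hm.le
      have a2 : θ^m0 ≤ θ^m := pow_le_pow_of_le_one hθ0.le hθ1.le hm.le
      calc H j * (e^m0 * θ^m0) ≤ H j * (e^m * θ^m) := by have := hH j; gcongr
        _ = θ^m * (e^m * H j) := by ring
        _ ≤ θ^m * H (j+m) := by gcongr; exact hs m j
    · obtain ⟨m', rfl⟩ := Nat.exists_eq_add_of_le hm
      have a1 := ih m' (by omega) (j+m0)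
      have a2 : H j ≤ θ^m0 * H (j+m0) := by
        calc H j ≤ (θ^m0 * R) * H j := le_mul_of_one_le_left (hH j) hθ
          _ = θ^m0 * (R * H j) := by ring
          _ ≤ _ := by gcongr; exact h2 j
      calc H j ≤ θ^m0 * H (j+m0) := a2
        _ ≤ θ^m0 * (1/((e*θ)^m0) * θ^m' * H (j+m0+m')) := by gcongr
        _ = _ := by rw [pow_add, add_assoc]; ring

/-- the auxiliary sequence: sum over `k` of `(k+1) κ (k+1)` times the `k`-th convolution power -/
noncomputable def auxB (κ ν : ℕ → ℝ) (j : ℕ) : ℝ := ∑' k : ℕ, ((k:ℝ)+1) * κ (k+1) * cpow ν k j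

lemma summable_kappa {κ : ℕ → ℝ} (hκ : ∀ i, 0 < κ i) {a q : ℝ}
    (hrec : ∀ k : ℕ, ((k:ℝ)+1) * κ (k+1) = q * (a + k) * κ k) (hq1 : q < 1) :
    Summable (fun k : ℕ => (k:ℝ) * κ k) := by
  have hlim : Tendsto (fun k : ℕ => q * (1 + a * ((k:ℝ))⁻¹)) atTop (nhds q) := by
    have := ((tendsto_inv_atTop_nhds_zero_nat (𝕜 := ℝ)).const_mul a).const_add 1 |>.const_mul q
    simpa using this
  refine summable_of_ratio_test_tendsto_lt_one hq1 ?_ (hlim.congr' ?_)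
  · filter_upwards [eventually_ge_atTop 1] with k hk
    have : (0:ℝ) < k := by exact_mod_cast hk
    have := hκ k
    positivity
  · filter_upwards [eventually_ge_atTop 1] with k hk
    have hk' : (0:ℝ) < k := by exact_mod_cast hk
    have h1 := hκ k
    have h2 := hκ (k+1)
    rw [Real.norm_of_nonneg (by positivity), Real.norm_of_nonneg (by positivity)]
    push_cast
    rw [hrec, eq_div_iff (by positivity)]
    field_simp
    ring

lemma summable_aux {κ ν : ℕ → ℝ} (hκ : ∀ i, 0 < κ i) (hν : ∀ i, 0 < ν i) (h0 : ν 0 < 1) {a q : ℝ}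
    (hrec : ∀ k : ℕ, ((k:ℝ)+1) * κ (k+1) = q * (a + k) * κ k) (hq1 : q < 1) (j : ℕ) :
    Summable (fun k : ℕ => ((k:ℝ)+1) * κ (k+1) * cpow ν k j) := by
  obtain ⟨C, hC⟩ := cpow_bdd (fun i => (hν i).le) h0 j
  have h1 : Summable (fun k : ℕ => (((k+1 : ℕ):ℝ)) * κ (k+1)) :=
    (summable_nat_add_iff 1).2 (summable_kappa hκ hrec hq1)
  refine Summable.of_nonneg_of_le (fun k => ?_) (fun k => ?_) (h1.mul_right C)
  · have := hκ (k+1)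
    have := cpow_nonneg (fun i => (hν i).le) k j
    positivity
  · have := hκ (k+1)
    push_cast
    exact mul_le_mul_of_nonneg_left (hC k) (by positivity)

lemma aux_pos {κ ν : ℕ → ℝ} (hκ : ∀ i, 0 < κ i) (hν : ∀ i, 0 < ν i) (h0 : ν 0 < 1) {a q : ℝ}
    (hrec : ∀ k : ℕ, ((k:ℝ)+1) * κ (k+1) = q * (a + k) * κ k) (hq1 : q < 1) (j : ℕ) :
    0 < auxB κ ν j := by
  refine (summable_aux hκ hν h0 hrec hq1 j).tsum_pos (fun k => ?_) 1 ?_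
  · have := hκ (k+1)
    have := cpow_nonneg (fun i => (hν i).le) k j
    positivity
  · rw [cpow_one]
    have := hκ (1+1)
    have := hν j
    positivity

lemma aux_growth {κ ν : ℕ → ℝ} (hκ : ∀ i, 0 < κ i) (hν : ∀ i, 0 < ν i) (h0 : ν 0 < 1) {a q : ℝ}
    (ha : 0 < a) (hq0 : 0 < q)
    (hrec : ∀ k : ℕ, ((k:ℝ)+1) * κ (k+1) = q * (a + k) * κ k) (hq1 : q < 1) (d m j : ℕ) :
    q ^ d * cpow ν d m * auxB κ ν j ≤ auxB κ ν (j+m) := by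
  have hν' : ∀ i, 0 ≤ ν i := fun i => (hν i).le
  have hstep : ∀ d k : ℕ, q ^ d * (((k:ℝ)+1) * κ (k+1)) ≤ (((k+d:ℕ):ℝ)+1) * κ (k+d+1) := by
    intro d k
    induction d with
    | zero => simp
    | succ d ih =>
      have h1 := hrec (k+d+1)
      have h2 := hκ (k+d+1)
      have h3 := mul_le_mul_of_nonneg_left ih hq0.le
      rw [← add_assoc k d 1, h1, pow_succ]
      have h4 : q * ((((k+d:ℕ):ℝ)+1) * κ (k+d+1)) ≤ q * (a + ((k+d+1:ℕ):ℝ)) * κ (k+d+1) := by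
        rw [mul_assoc]
        refine mul_le_mul_of_nonneg_left (mul_le_mul_of_nonneg_right ?_ h2.le) hq0.le
        push_cast
        linarith
      linarith
  have hs := summable_aux hκ hν h0 hrec hq1 (j+m)
  have hs' : Summable (fun k : ℕ => (((k+d:ℕ):ℝ)+1) * κ (k+d+1) * cpow ν (k+d) (j+m)) :=
    (summable_nat_add_iff d).2 hs
  rw [auxB, ← tsum_mul_left]
  calc ∑' k : ℕ, q ^ d * cpow ν d m * (((k:ℝ)+1) * κ (k+1) * cpow ν k j)
      ≤ ∑' k : ℕ, (((k+d:ℕ):ℝ)+1) * κ (k+d+1) * cpow ν (k+d) (j+m) := by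
        refine Summable.tsum_le_tsum (fun k => ?_) ((summable_aux hκ hν h0 hrec hq1 j).mul_left _) hs'
        calc q ^ d * cpow ν d m * (((k:ℝ)+1) * κ (k+1) * cpow ν k j)
            = (q ^ d * (((k:ℝ)+1) * κ (k+1))) * (cpow ν k j * cpow ν d m) := by ring
          _ ≤ _ := by
            have := hκ (k+d+1)
            exact mul_le_mul (hstep d k) (cpow_mul_le hν' k d j m)
              (mul_nonneg (cpow_nonneg hν' _ _) (cpow_nonneg hν' _ _)) (by positivity)
    _ ≤ auxB κ ν (j+m) := by
        rw [auxB, ← hs.sum_add_tsum_nat_add d]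
        refine le_add_of_nonneg_left (Finset.sum_nonneg fun k _ => ?_)
        have := hκ (k+1)
        have := cpow_nonneg hν' k (j+m)
        positivity

lemma hasSum_marked {κ ν : ℕ → ℝ} (hκ : ∀ i, 0 < κ i) (hν : ∀ i, 0 < ν i) (h0 : ν 0 < 1) {a q : ℝ}
    (hrec : ∀ k : ℕ, ((k:ℝ)+1) * κ (k+1) = q * (a + k) * κ k) (hq1 : q < 1) (n : ℕ) (φ : ℕ → ℝ) :
    HasSum (fun k : ℕ => κ k * ∑ v ∈ Finset.piAntidiag (Finset.univ : Finset (Fin k)) n,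
        (∑ i, φ (v i)) * ∏ l, ν (v l))
      (∑ x ∈ Finset.HasAntidiagonal.antidiagonal n, φ x.1 * ν x.1 * auxB κ ν x.2) := by
  rw [← hasSum_nat_add_iff' 1]
  simp only [Finset.range_one, Finset.sum_singleton, Finset.univ_eq_empty, Finset.sum_empty, zero_mul,
    Finset.sum_const_zero, mul_zero, sub_zero]
  have h : ∀ k : ℕ, κ (k+1) * ∑ v ∈ Finset.piAntidiag (Finset.univ : Finset (Fin (k+1))) n,
        (∑ i, φ (v i)) * ∏ l, ν (v l)
      = ∑ x ∈ Finset.HasAntidiagonal.antidiagonal n,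
        φ x.1 * ν x.1 * (((k:ℝ)+1) * κ (k+1) * cpow ν k x.2) := by
    intro k
    simp_rw [Finset.sum_mul]
    rw [Finset.sum_comm]
    simp_rw [marked]
    simp only [Finset.sum_const, Finset.card_univ, Fintype.card_fin, nsmul_eq_mul, Finset.mul_sum]
    refine Finset.sum_congr rfl fun x _ => ?_
    push_cast
    ring
  simp_rw [h]
  exact hasSum_sum fun x _ => ((summable_aux hκ hν h0 hrec hq1 x.2).hasSum.mul_left _)

lemma summable_nu {ν : ℕ → ℝ} (hν : ∀ i, 0 < ν i) {r : ℝ}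
    (hrec : ∀ k : ℕ, ((k:ℝ)+1) * ν (k+1) = (r + k) * ν k) {θ : ℝ} (hθ0 : 0 < θ) (hθ1 : θ < 1) :
    Summable (fun k : ℕ => (k:ℝ) * (ν k * θ ^ k)) := by
  refine summable_kappa (κ := fun k => ν k * θ ^ k) (a := r) (q := θ)
    (fun i => by have := hν i; positivity) (fun k => ?_) hθ1
  have := hrec k
  simp only [pow_succ]
  linear_combination θ ^ k * θ * this

lemma main_abs {κ ν : ℕ → ℝ} (hκ : ∀ i, 0 < κ i) (hν : ∀ i, 0 < ν i) (h0 : ν 0 < 1) {a q r : ℝ}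
    (ha : 0 < a) (hq0 : 0 < q) (hr : 0 < r)
    (hrec : ∀ k : ℕ, ((k:ℝ)+1) * κ (k+1) = q * (a + k) * κ k) (hq1 : q < 1)
    (hrec2 : ∀ k : ℕ, ((k:ℝ)+1) * ν (k+1) = (r + k) * ν k) (ε : ℝ) (hε : 0 < ε) :
    Tendsto (fun n : ℕ => kpCondProb κ ν n (fun k v => ε ≤ ((Finset.univ.sup v : ℕ) : ℝ) / n))
      atTop (nhds 0) := by
  have hν' : ∀ i, 0 ≤ ν i := fun i => (hν i).le
  obtain ⟨d, m0, hm0, hbig⟩ := exists_big hν h0 hr hrec2 hq0 hq1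
  have hBpos := aux_pos hκ hν h0 hrec hq1
  obtain ⟨θ, C, hθ0, hθ1, hC, hgr⟩ := growth (auxB κ ν) (fun j => (hBpos j).le) (q ^ 1 * cpow ν 1 1) _
    (by rw [cpow_one]; have := hν 1; positivity) hbig m0 hm0
    (aux_growth hκ hν h0 ha hq0 hrec hq1 1 1) (aux_growth hκ hν h0 ha hq0 hrec hq1 d m0)
  set g : ℕ → ℝ := fun k => (k:ℝ) * (ν k * θ ^ k) with hg
  have hgs : Summable g := summable_nu hν hrec2 hθ0 hθ1
  have hg0 : ∀ k, 0 ≤ g k := fun k => by have := hν k; simp only [hg]; positivity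
  set T : ℝ := C / (θ * ν 1 * ε) with hT
  have htail : Tendsto (fun n : ℕ => T * ∑' k, g (k + ⌈ε * n⌉₊)) atTop (nhds 0) := by
    have h1 : Tendsto (fun n : ℕ => ⌈ε * (n:ℝ)⌉₊) atTop atTop :=
      tendsto_nat_ceil_atTop.comp (tendsto_natCast_atTop_atTop.const_mul_atTop hε)
    have := ((tendsto_sum_nat_add g).comp h1).const_mul T
    simpa using this
  refine squeeze_zero' (Eventually.of_forall fun n => ?_) ?_ htail
  · unfold kpCondProb
    refine div_nonneg (tsum_nonneg fun k => mul_nonneg (hκ k).le (tsum_nonneg fun v => ?_))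
      (tsum_nonneg fun k => mul_nonneg (hκ k).le (tsum_nonneg fun v => ?_)) <;>
    · split_ifs
      · exact Finset.prod_nonneg fun i _ => hν' _
      · exact le_rfl
  filter_upwards [eventually_ge_atTop 1] with n hn
  have hn' : (0:ℝ) < n := by exact_mod_cast hn
  set φ : ℕ → ℝ := fun m => if ε * n ≤ m then 1 else 0 with hφ
  have hφ0 : ∀ m, 0 ≤ φ m := fun m => by simp only [hφ]; split_ifs <;> norm_num
  unfold kpCondProb
  simp_rw [inner_tsum, inner_tsum']
  have hden := hasSum_marked hκ hν h0 hrec hq1 n (fun m => (m:ℝ))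
  have hden2 : HasSum (fun k : ℕ => (n:ℝ) * (κ k * cpow ν k n))
      (∑ x ∈ Finset.HasAntidiagonal.antidiagonal n, (x.1:ℝ) * ν x.1 * auxB κ ν x.2) := by
    convert hden using 2 with k
    rw [cpow_eq, mul_left_comm, Finset.mul_sum]
    congr 1
    refine Finset.sum_congr rfl fun v hv => ?_
    have : ∑ i, v i = n := by simpa using hv
    rw [← this]
    push_cast
    rfl
  have hD : (n:ℝ) * ∑' k : ℕ, κ k * cpow ν k n
      = ∑ x ∈ Finset.HasAntidiagonal.antidiagonal n, (x.1:ℝ) * ν x.1 * auxB κ ν x.2 := by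
    rw [← tsum_mul_left]; exact hden2.tsum_eq
  have hDlow : ν 1 * auxB κ ν (n-1) ≤ (n:ℝ) * ∑' k : ℕ, κ k * cpow ν k n := by
    rw [hD]
    have := Finset.single_le_sum (f := fun x : ℕ × ℕ => (x.1:ℝ) * ν x.1 * auxB κ ν x.2)
      (s := Finset.HasAntidiagonal.antidiagonal n)
      (fun x _ => mul_nonneg (mul_nonneg (Nat.cast_nonneg _) (hν' _)) (hBpos _).le)
      (show (1, n-1) ∈ Finset.HasAntidiagonal.antidiagonal n by
        rw [Finset.HasAntidiagonal.mem_antidiagonal]; omega)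
    simpa using this
  have hDpos : 0 < ∑' k : ℕ, κ k * cpow ν k n := by
    have h1 := mul_pos (hν 1) (hBpos (n-1))
    exact pos_of_mul_pos_right (h1.trans_le hDlow) hn'.le
  have hnum := hasSum_marked hκ hν h0 hrec hq1 n φ
  have hle : ∀ k : ℕ, κ k * (∑ v ∈ Finset.piAntidiag (Finset.univ : Finset (Fin k)) n,
          if ε ≤ ((Finset.univ.sup v : ℕ) : ℝ) / n then ∏ i, ν (v i) else 0)
      ≤ κ k * ∑ v ∈ Finset.piAntidiag (Finset.univ : Finset (Fin k)) n,
        (∑ i, φ (v i)) * ∏ l, ν (v l) := by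
    intro k
    refine mul_le_mul_of_nonneg_left (Finset.sum_le_sum fun v _ => ?_) (hκ k).le
    have hp : 0 ≤ ∏ i, ν (v i) := Finset.prod_nonneg fun i _ => hν' _
    split_ifs with hE
    · refine le_mul_of_one_le_left hp ?_
      rw [le_div_iff₀ hn'] at hE
      rcases (Finset.univ : Finset (Fin k)).eq_empty_or_nonempty with he | he
      · rw [he] at hE
        simp at hE
        nlinarith
      · obtain ⟨i, _, hi⟩ := Finset.exists_mem_eq_sup _ he v
        rw [hi] at hE
        have h1 : φ (v i) = 1 := by simp only [hφ]; rw [if_pos hE]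
        rw [← h1]
        exact Finset.single_le_sum (f := fun i => φ (v i)) (fun i _ => hφ0 _) (Finset.mem_univ i)
    · exact mul_nonneg (Finset.sum_nonneg fun i _ => hφ0 _) hp
  have hN : (∑' k : ℕ, κ k * (∑ v ∈ Finset.piAntidiag (Finset.univ : Finset (Fin k)) n,
          if ε ≤ ((Finset.univ.sup v : ℕ) : ℝ) / n then ∏ i, ν (v i) else 0))
      ≤ ∑ x ∈ Finset.HasAntidiagonal.antidiagonal n, φ x.1 * ν x.1 * auxB κ ν x.2 := by
    rw [← hnum.tsum_eq]
    refine Summable.tsum_le_tsum hle (Summable.of_nonneg_of_le (fun k => ?_) hle hnum.summable) hnum.summable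
    refine mul_nonneg (hκ k).le (Finset.sum_nonneg fun v _ => ?_)
    split_ifs
    · exact Finset.prod_nonneg fun i _ => hν' _
    · exact le_rfl
  rw [div_le_iff₀ hDpos]
  refine hN.trans ?_
  have hterm : ∀ x ∈ Finset.HasAntidiagonal.antidiagonal n, φ x.1 * ν x.1 * auxB κ ν x.2
      ≤ (if ⌈ε * n⌉₊ ≤ x.1 then g x.1 else 0) * (C / (θ * (ε * n)) * auxB κ ν (n-1)) := by
    intro x hx
    rw [Finset.HasAntidiagonal.mem_antidiagonal] at hx
    simp only [hφ]
    by_cases hc : ε * n ≤ x.1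
    · rw [if_pos hc, if_pos (Nat.ceil_le.2 hc)]
      have hx1 : (0:ℝ) < x.1 := lt_of_lt_of_le (by positivity) hc
      have hx1' : 0 < x.1 := by exact_mod_cast hx1
      have h1 := hgr x.2 (x.1 - 1)
      have h2 : x.2 + (x.1 - 1) = n - 1 := by omega
      rw [h2] at h1
      have h3 : θ ^ x.1 = θ ^ (x.1 - 1) * θ := by rw [← pow_succ]; congr 1; omega
      have hb := hBpos (n-1)
      have hv := hν x.1
      calc 1 * ν x.1 * auxB κ ν x.2 ≤ 1 * ν x.1 * (C * θ ^ (x.1-1) * auxB κ ν (n-1)) := by gcongr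
        _ ≤ (x.1 / (ε * n)) * ν x.1 * (C * θ ^ (x.1-1) * auxB κ ν (n-1)) := by
          gcongr
          rwa [one_le_div (by positivity)]
        _ = _ := by
          simp only [hg]
          rw [h3]
          field_simp
    · rw [if_neg hc, if_neg (by rwa [Nat.ceil_le])]
      simp
  refine (Finset.sum_le_sum hterm).trans ?_
  rw [← Finset.sum_mul, Finset.Nat.sum_antidiagonal_eq_sum_range_succ_mk]
  have hsum : (∑ k ∈ Finset.range n.succ, if ⌈ε * n⌉₊ ≤ k then g k else 0)
      ≤ ∑' k, g (k + ⌈ε * n⌉₊) := by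
    set N := ⌈ε * n⌉₊
    set G : ℕ → ℝ := fun k => if N ≤ k then g k else 0 with hG
    have hG0 : ∀ k, 0 ≤ G k := fun k => by simp only [hG]; split_ifs; exacts [hg0 k, le_rfl]
    have hGs : Summable G := Summable.of_nonneg_of_le hG0
      (fun k => by simp only [hG]; split_ifs; exacts [le_rfl, hg0 k]) hgs
    refine (hGs.sum_le_tsum _ fun k _ => hG0 k).trans ?_
    rw [← hGs.sum_add_tsum_nat_add N]
    have : ∑ k ∈ Finset.range N, G k = 0 := Finset.sum_eq_zero fun k hk => by
      simp only [hG]; rw [if_neg (by simpa using hk)]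
    rw [this, zero_add]
    simp [hG]
  have hts : 0 ≤ ∑' k, g (k + ⌈ε * n⌉₊) := tsum_nonneg fun k => hg0 _
  have hb := hBpos (n-1)
  have hv := hν 1
  calc _ ≤ (∑' k, g (k + ⌈ε * n⌉₊)) * (C / (θ * (ε * n)) * auxB κ ν (n-1)) := by gcongr
    _ = (∑' k, g (k + ⌈ε * n⌉₊)) * (T / n) * (ν 1 * auxB κ ν (n-1)) := by
      simp only [hT]; field_simp
    _ ≤ (∑' k, g (k + ⌈ε * n⌉₊)) * (T / n) * (n * ∑' k : ℕ, κ k * cpow ν k n) := by gcongr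
    _ = _ := by field_simp

lemma kp_scale (κ ν : ℕ → ℝ) {p : ℝ} (hp : 0 < p) (n : ℕ) (E : ∀ k : ℕ, (Fin k → ℕ) → Prop) :
    kpCondProb κ (fun y => ν y * p ^ y) n E = kpCondProb κ ν n E := by
  unfold kpCondProb
  have h : ∀ (k : ℕ) (Q : (Fin k → ℕ) → Prop) (v : Fin k → ℕ), (∑ i, v i = n) →
      ∏ i, (ν (v i) * p ^ (v i)) = (∏ i, ν (v i)) * p ^ n := by
    intro k Q v hv
    rw [Finset.prod_mul_distrib, Finset.prod_pow_eq_pow_sum, hv]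
  have h1 : ∀ (k : ℕ) (v : Fin k → ℕ), (if (∑ i, v i) = n ∧ E k v then ∏ i, (ν (v i) * p ^ (v i)) else 0)
      = (if (∑ i, v i) = n ∧ E k v then ∏ i, ν (v i) else 0) * p ^ n := by
    intro k v
    split_ifs with hc
    · exact h k (E k) v hc.1
    · simp
  have h2 : ∀ (k : ℕ) (v : Fin k → ℕ), (if (∑ i, v i) = n then ∏ i, (ν (v i) * p ^ (v i)) else 0)
      = (if (∑ i, v i) = n then ∏ i, ν (v i) else 0) * p ^ n := by
    intro k v
    split_ifs with hc
    · exact h k (E k) v hc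
    · simp
  simp_rw [h1, h2, tsum_mul_right, ← mul_assoc, tsum_mul_right]
  exact mul_div_mul_right _ _ (by positivity)

lemma gamma_rec {r : ℝ} (hr : 0 < r) (k : ℕ) :
    ((k:ℝ)+1) * (Real.Gamma ((k+1:ℕ) + r) / ((k+1).factorial * Real.Gamma r))
      = (r + k) * (Real.Gamma (k + r) / (k.factorial * Real.Gamma r)) := by
  have h : (((k+1:ℕ):ℝ) + r) = (k + r) + 1 := by push_cast; ring
  have hk : (k:ℝ) + r ≠ 0 := by positivity
  have := (Real.Gamma_pos_of_pos hr).ne'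
  have hf : (k.factorial : ℝ) ≠ 0 := by positivity
  rw [h, Real.Gamma_add_one hk, Nat.factorial_succ]
  push_cast
  field_simp
  ring

/-- Let `C_N` be drawn from a Kolchin partition model with `κ = NegBin(a,q)` and
`μ = NegBin(r,p)` (untruncated), for fixed `a, r > 0` and `q, p ∈ (0,1)`.  Let `M_N`
denote the size of the largest cluster in `C_N`.  Then for all `ε > 0`,
`P(M_N / N ≥ ε | N = n) → 0` as `n → ∞`: the model exhibits the microclustering
property. -/
theorem nbnb_variant_microclustering (a q r p : ℝ)
    (ha : 0 < a) (hq0 : 0 < q) (hq1 : q < 1) (hr : 0 < r) (hp0 : 0 < p) (hp1 : p < 1)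
    (ε : ℝ) (hε : 0 < ε) :
    Tendsto (fun n : ℕ =>
        kpCondProb (negBinPmf a q) (negBinPmf r p) n
          (fun k v => ε ≤ ((Finset.univ.sup v : ℕ) : ℝ) / n))
      atTop (nhds 0) := by

  have hpp : 0 < (1 - p) ^ r := Real.rpow_pos_of_pos (by linarith) r
  have hqq : 0 < (1 - q) ^ a := Real.rpow_pos_of_pos (by linarith) a
  set ν : ℕ → ℝ := fun y => Real.Gamma (y + r) / (Nat.factorial y * Real.Gamma r) * (1 - p) ^ r with hν
  have hΓ := Real.Gamma_pos_of_pos hr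
  have hΓa := Real.Gamma_pos_of_pos ha
  have he : negBinPmf r p = fun y => ν y * p ^ y := rfl
  rw [he]
  simp_rw [kp_scale _ ν hp0]
  refine main_abs (a := a) (q := q) (r := r) ?_ ?_ ?_ ha hq0 hr ?_ hq1 ?_ ε hε
  · intro k
    have : 0 < Real.Gamma (k + a) := Real.Gamma_pos_of_pos (by positivity)
    unfold negBinPmf
    positivity
  · intro k
    have : 0 < Real.Gamma (k + r) := Real.Gamma_pos_of_pos (by positivity)
    simp only [hν]
    positivity
  · simp only [hν]
    simp only [Nat.cast_zero, zero_add, Nat.factorial_zero, Nat.cast_one, one_mul, div_self hΓ.ne']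
    exact Real.rpow_lt_one (by linarith) (by linarith) hr
  · intro k
    have := gamma_rec ha k
    unfold negBinPmf
    rw [pow_succ]
    linear_combination ((1 - q) ^ a * q ^ k * q) * this
  · intro k
    have := gamma_rec hr k
    simp only [hν]
    linear_combination ((1 - p) ^ r) * this
end
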